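/- Let n ≥ 2, 1 < p < n, x₀ ∈ ℝⁿ, 0 < ρ < R, and let F ∈ L^p(B_R(x₀), ℝ^N). Suppose there exists M > 0 such that Σ_{s=1}^{n} ∫_{B_ρ(x₀)} |F(x + h e_s) − F(x)|^p dx ≤ M^p |h|^p for all real h with 0 < |h| < (R − ρ)/2, where e_s denotes the s-th standard basis vector of ℝⁿ. Then F ∈ L^{np/(n−p)}(B_ρ(x₀), ℝ^N) and ‖F‖_{L^{np/(n−p)}(B_ρ(x₀))} ≤ c ( M + ‖F‖_{L^p(B_R(x₀))} ), with a constant c = c(n, N, p, ρ, R). -/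

import Mathlib

open MeasureTheory Metric
open Set Filter Module
open scoped ENNReal NNReal Topology

section MeasureSpace

variable {E : Type*} [MeasurableSpace E] (μ : Measure E)

lemma setLIntegral_le_rpow_mul {f : E → ℝ≥0∞} {B : Set E}
    (hf : AEMeasurable f (μ.restrict B)) {p : ℝ} (hp : 1 < p) :
    ∫⁻ x in B, f x ∂μ ≤ μ B ^ (1 - 1 / p) * (∫⁻ x in B, f x ^ p ∂μ) ^ (1 / p) := by
  have h1 := ENNReal.lintegral_mul_le_Lp_mul_Lq (μ.restrict B)
    (Real.HolderConjugate.conjExponent hp) hf (aemeasurable_const (b := (1 : ℝ≥0∞)))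
  simp only [Pi.mul_apply, mul_one, ENNReal.one_rpow, lintegral_one, Measure.restrict_apply_univ]
    at h1
  have e1 : 1 / (p / (p - 1)) = 1 - 1 / p := by field_simp
  rw [Real.conjExponent, e1] at h1
  rwa [mul_comm]

/-- If the superlevel sets of `f` above `m₀` are controlled by truncated integrals of `g`, then an
`L^p` bound on `g` gives an `L^q` bound on `f`, with `q = a p`. -/
lemma lintegral_rpow_le_of_measure_gt_le {f : E → ℝ} (ν : Measure E) (hf : Measurable f)
    (hf0 : ∀ x, 0 ≤ f x) {g : E → ℝ≥0∞} (hg : Measurable g) (hg' : ∀ x, g x ≠ ∞) {a p m₀ : ℝ}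
    (ha : 1 < a) (hp : 1 < p) (hm₀ : 0 < m₀) {W : ℝ≥0∞}
    (h : ∀ m, m₀ ≤ m → ν {x | m < f x} ≤
      W * ENNReal.ofReal (m ^ (-a)) * ∫⁻ x in {x | ENNReal.ofReal (m ^ a) < g x}, g x ∂μ) :
    ∫⁻ x, ENNReal.ofReal (f x ^ (a * p)) ∂ν ≤ ENNReal.ofReal (a * p) *
      (ν univ * ENNReal.ofReal (m₀ ^ (a * p)) +
        W * (ENNReal.ofReal (a * p - a))⁻¹ * ∫⁻ x, g x ^ p ∂μ) := by
  set q := a * p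
  have ha0 : 0 < a := by linarith
  have hqa : 0 < q - a := by simp only [q]; nlinarith
  have hq1 : 0 < q - 1 := by linarith
  rw [lintegral_rpow_eq_lintegral_meas_lt_mul ν (Eventually.of_forall hf0) hf.aemeasurable
    (by linarith : 0 < q)]
  gcongr
  rw [← Ioc_union_Ioi_eq_Ioi hm₀.le]
  refine (lintegral_union_le _ _ _).trans (add_le_add ?_ ?_)
  · calc _ ≤ ∫⁻ t in Ioc 0 m₀, ν univ * ENNReal.ofReal (m₀ ^ (q - 1)) := by
          refine setLIntegral_mono' measurableSet_Ioc fun t ht => ?_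
          gcongr
          · exact subset_univ _
          · exact ht.1.le
          · exact ht.2
      _ = _ := by
          rw [setLIntegral_const, Real.volume_Ioc, sub_zero, mul_assoc,
            ← ENNReal.ofReal_mul (by positivity), Real.rpow_sub hm₀, Real.rpow_one,
            div_mul_cancel₀ _ hm₀.ne']
  · set ν' := μ.withDensity g
    set f' : E → ℝ := fun x => (g x).toReal ^ (1 / a)
    have hf' : Measurable f' := hg.ennreal_toReal.pow_const _
    have hf'0 : ∀ x, 0 ≤ f' x := fun x => by positivity
    have hcake := lintegral_rpow_eq_lintegral_meas_lt_mul ν' (Eventually.of_forall hf'0)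
      hf'.aemeasurable hqa
    have hval : ∫⁻ x, ENNReal.ofReal (f' x ^ (q - a)) ∂ν' = ∫⁻ x, g x ^ p ∂μ := by
      rw [lintegral_withDensity_eq_lintegral_mul _ hg (by fun_prop)]
      refine lintegral_congr fun x => ?_
      have e : 1 / a * (q - a) = p - 1 := by simp only [q]; field_simp
      simp only [Pi.mul_apply, f']
      rw [← Real.rpow_mul ENNReal.toReal_nonneg, e,
        ← ENNReal.ofReal_rpow_of_nonneg ENNReal.toReal_nonneg (by linarith),
        ENNReal.ofReal_toReal (hg' x)]
      have : g x * g x ^ (p - 1) = g x ^ (1 : ℝ) * g x ^ (p - 1) := by rw [ENNReal.rpow_one]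
      rw [this, ← ENNReal.rpow_add_of_nonneg _ _ zero_le_one (by linarith), add_sub_cancel]
    have hset : ∀ t, 0 < t → {x | ENNReal.ofReal (t ^ a) < g x} = {x | t < f' x} := by
      intro t ht
      ext x
      simp only [mem_ofPred_eq, f']
      rw [ENNReal.ofReal_lt_iff_lt_toReal (by positivity) (hg' x), one_div,
        Real.lt_rpow_inv_iff_of_pos ht.le ENNReal.toReal_nonneg ha0]
    calc _ ≤ ∫⁻ t in Ioi m₀, W * (ν' {x | t < f' x} * ENNReal.ofReal (t ^ (q - a - 1))) := by
          refine setLIntegral_mono' measurableSet_Ioi fun t ht => ?_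
          have ht0 : 0 < t := hm₀.trans ht
          have e1 : ν' {x | t < f' x} = ∫⁻ x in {x | ENNReal.ofReal (t ^ a) < g x}, g x ∂μ := by
            rw [hset t ht0, withDensity_apply _ (measurableSet_lt measurable_const hf')]
          have e2 : ENNReal.ofReal (t ^ (q - a - 1)) =
              ENNReal.ofReal (t ^ (-a)) * ENNReal.ofReal (t ^ (q - 1)) := by
            rw [← ENNReal.ofReal_mul (by positivity), ← Real.rpow_add ht0]
            congr 2; ring
          rw [e1, e2]
          refine (mul_le_mul_left (h t (le_of_lt ht)) _).trans_eq ?_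
          ring
      _ ≤ ∫⁻ t in Ioi 0, W * (ν' {x | t < f' x} * ENNReal.ofReal (t ^ (q - a - 1))) :=
          lintegral_mono_set (Ioi_subset_Ioi hm₀.le)
      _ = W * ∫⁻ t in Ioi 0, ν' {x | t < f' x} * ENNReal.ofReal (t ^ (q - a - 1)) := by
          refine lintegral_const_mul _ (Measurable.mul ?_ (by fun_prop))
          exact Antitone.measurable fun s t hst => measure_mono fun x hx => lt_of_le_of_lt hst hx
      _ = _ := by
          rw [← hval, hcake, mul_assoc W, ← mul_assoc (ENNReal.ofReal (q - a))⁻¹,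
            ENNReal.inv_mul_cancel (by simpa using hqa) ENNReal.ofReal_ne_top, one_mul]

end MeasureSpace

section Potential

variable {E : Type*} [NormedAddCommGroup E] [NormedSpace ℝ E] [FiniteDimensional ℝ E]
  [MeasurableSpace E] [BorelSpace E]

/-- The segment potential of `g`: the integral of `g` over all segments from `x` to a point of `B`,
with parameter in `J`. -/
noncomputable def segmentPotential (μ : Measure E) (B : Set E) (g : E → ℝ≥0∞) (J : Set ℝ)
    (x : E) : ℝ≥0∞ :=
  ∫⁻ t in J, ∫⁻ y in B, g ((1 - t) • x + t • y) ∂μ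

variable (μ : Measure E) [μ.IsAddHaarMeasure]

lemma lintegral_comp_add_smul {g : E → ℝ≥0∞} (hg : Measurable g) (w : E) {c : ℝ} (hc : 0 < c) :
    ∫⁻ y, g (w + c • y) ∂μ = ENNReal.ofReal (c ^ (-(finrank ℝ E : ℝ))) * ∫⁻ y, g y ∂μ := by
  have h1 : ∫⁻ y, g (w + c • y) ∂μ = ∫⁻ y, g (w + y) ∂(μ.map (c • ·)) := by
    rw [lintegral_map (by fun_prop) (by fun_prop)]
  rw [h1, Measure.map_addHaar_smul μ hc.ne', lintegral_smul_measure, lintegral_add_left_eq_self,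
    smul_eq_mul, abs_of_pos (by positivity), Real.rpow_neg hc.le, Real.rpow_natCast]

lemma measurable_segment_comp {g : E → ℝ≥0∞} (hg : Measurable g) :
    Measurable fun z : (E × ℝ) × E => g ((1 - z.1.2) • z.1.1 + z.1.2 • z.2) := by
  fun_prop

lemma measurable_lintegral_segment {g : E → ℝ≥0∞} (hg : Measurable g) (B : Set E) :
    Measurable fun z : E × ℝ => ∫⁻ y in B, g ((1 - z.2) • z.1 + z.2 • y) ∂μ :=
  (measurable_segment_comp hg).lintegral_prod_right'

lemma measurable_segmentPotential {g : E → ℝ≥0∞} (hg : Measurable g) (B : Set E) (J : Set ℝ) :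
    Measurable (segmentPotential μ B g J) :=
  (measurable_lintegral_segment μ hg B).lintegral_prod_right'

lemma lintegral_segmentPotential_near_le {g : E → ℝ≥0∞} (hg : Measurable g) (B : Set E) {δ : ℝ}
    (hδ : δ ≤ 1 / 2) :
    ∫⁻ x, segmentPotential μ B g (Ioc 0 δ) x ∂μ ≤
      ENNReal.ofReal δ * μ B * ENNReal.ofReal (2 ^ (finrank ℝ E : ℝ)) * ∫⁻ x, g x ∂μ := by
  unfold segmentPotential
  rw [lintegral_lintegral_swap (measurable_lintegral_segment μ hg B).aemeasurable]
  calc ∫⁻ t in Ioc 0 δ, ∫⁻ x, ∫⁻ y in B, g ((1 - t) • x + t • y) ∂μ ∂μ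
      ≤ ∫⁻ t in Ioc 0 δ, μ B * ENNReal.ofReal (2 ^ (finrank ℝ E : ℝ)) * ∫⁻ x, g x ∂μ := by
        refine setLIntegral_mono' measurableSet_Ioc fun t ht => ?_
        have ht' : 1 / 2 ≤ 1 - t := by linarith [ht.2]
        have hm : Measurable fun z : E × E => g ((1 - t) • z.1 + t • z.2) := by fun_prop
        rw [lintegral_lintegral_swap hm.aemeasurable]
        calc ∫⁻ y in B, ∫⁻ x, g ((1 - t) • x + t • y) ∂μ ∂μ
            ≤ ∫⁻ y in B, ENNReal.ofReal (2 ^ (finrank ℝ E : ℝ)) * ∫⁻ x, g x ∂μ ∂μ := by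
              refine lintegral_mono fun y => ?_
              simp_rw [add_comm _ (t • y)]
              rw [lintegral_comp_add_smul μ hg (t • y) (by linarith : (0:ℝ) < 1 - t)]
              gcongr
              rw [Real.rpow_neg (by linarith), ← Real.inv_rpow (by linarith)]
              refine Real.rpow_le_rpow (inv_nonneg.2 (by linarith)) ?_ (by positivity)
              rw [inv_le_comm₀ (by linarith) (by norm_num)]
              linarith
          _ = _ := by
              rw [setLIntegral_const]; ring
    _ = _ := by
        rw [setLIntegral_const, Real.volume_Ioc, sub_zero]; ring

lemma segmentPotential_far_le {g : E → ℝ≥0∞} (hg : Measurable g) (B : Set E) {p δ : ℝ}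
    (hp : 1 < p) (hpd : p < finrank ℝ E) (hδ : 0 < δ) (x : E) :
    segmentPotential μ B g (Ioc δ 1) x ≤
      μ B ^ (1 - 1 / p) * (∫⁻ y, g y ^ p ∂μ) ^ (1 / p) *
        ENNReal.ofReal (((finrank ℝ E : ℝ) / p - 1)⁻¹ * δ ^ (1 - (finrank ℝ E : ℝ) / p)) := by
  have hp0 : 0 < p := by linarith
  set d : ℝ := (finrank ℝ E : ℝ)
  have hdp : 1 < d / p := by rwa [one_lt_div hp0]
  set K := μ B ^ (1 - 1 / p) * (∫⁻ y, g y ^ p ∂μ) ^ (1 / p) with hK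
  have key : ∀ t ∈ Ioc δ 1, ∫⁻ y in B, g ((1 - t) • x + t • y) ∂μ ≤
      K * ENNReal.ofReal (t ^ (-(d / p))) := by
    intro t ht
    have ht0 : 0 < t := hδ.trans ht.1
    have hm : Measurable fun y => g ((1 - t) • x + t • y) := by fun_prop
    have h2 : ∫⁻ y in B, g ((1 - t) • x + t • y) ^ p ∂μ ≤
        ENNReal.ofReal (t ^ (-d)) * ∫⁻ y, g y ^ p ∂μ :=
      (setLIntegral_le_lintegral _ _).trans_eq
        (lintegral_comp_add_smul μ (hg.pow_const p) ((1 - t) • x) ht0)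
    refine (setLIntegral_le_rpow_mul μ hm.aemeasurable hp).trans ?_
    rw [hK]
    calc _ ≤ μ B ^ (1 - 1 / p) * (ENNReal.ofReal (t ^ (-d)) * ∫⁻ y, g y ^ p ∂μ) ^ (1 / p) := by
          gcongr
      _ = _ := by
          rw [ENNReal.mul_rpow_of_nonneg _ _ (by positivity),
            ENNReal.ofReal_rpow_of_nonneg (by positivity) (by positivity), ← Real.rpow_mul ht0.le]
          have : -d * (1 / p) = -(d / p) := by ring
          rw [this]; ring
  calc segmentPotential μ B g (Ioc δ 1) x
      ≤ ∫⁻ t in Ioc δ 1, K * ENNReal.ofReal (t ^ (-(d / p))) :=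
        setLIntegral_mono' measurableSet_Ioc key
    _ ≤ ∫⁻ t in Ioi δ, K * ENNReal.ofReal (t ^ (-(d / p))) :=
        lintegral_mono_set Ioc_subset_Ioi_self
    _ = K * ∫⁻ t in Ioi δ, ENNReal.ofReal (t ^ (-(d / p))) :=
        lintegral_const_mul _ (by fun_prop)
    _ = _ := by
        rw [← ofReal_integral_eq_lintegral_ofReal (integrableOn_Ioi_rpow_of_lt (by linarith) hδ)
          ((ae_restrict_mem measurableSet_Ioi).mono fun t ht =>
            Real.rpow_nonneg (hδ.trans ht).le _), integral_Ioi_rpow_of_lt (by linarith) hδ]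
        congr 2
        have e : -(d / p) + 1 = 1 - d / p := by ring
        rw [e, neg_div, ← div_neg, neg_sub, div_eq_inv_mul]

/-- Weak-type estimate for the segment potential, in terms of the truncated integral of `g`. -/
lemma measure_segmentPotential_gt_le {g : E → ℝ≥0∞} (hg : Measurable g) (B : Set E) {p δ : ℝ}
    (hp : 1 < p) (hpd : p < finrank ℝ E) (hδ : 0 < δ) (hδ' : δ ≤ 1 / 2) :
    μ {x | (μ B ^ (1 - 1 / p) * (∫⁻ y, g y ^ p ∂μ) ^ (1 / p) *
        ENNReal.ofReal (((finrank ℝ E : ℝ) / p - 1)⁻¹) + μ B + 1) *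
        ENNReal.ofReal (δ ^ (1 - (finrank ℝ E : ℝ) / p)) < segmentPotential μ B g (Ioc 0 1) x} ≤
      μ B * ENNReal.ofReal (2 ^ (finrank ℝ E : ℝ)) *
        ENNReal.ofReal (δ ^ ((finrank ℝ E : ℝ) / p)) *
          ∫⁻ x in {x | ENNReal.ofReal (δ ^ (-((finrank ℝ E : ℝ) / p))) < g x}, g x ∂μ := by
  have hp0 : 0 < p := by linarith
  set d : ℝ := (finrank ℝ E : ℝ)
  have hdp : 1 < d / p := by rwa [one_lt_div hp0]
  set s := ENNReal.ofReal (δ ^ (-(d / p))) with hs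
  set S := {x | s < g x}
  have hS : MeasurableSet S := measurableSet_lt measurable_const hg
  set k := S.indicator g
  have hk : Measurable k := hg.indicator hS
  set η := ENNReal.ofReal (δ ^ (1 - d / p)) with hη
  have hη0 : η ≠ 0 := by simp only [hη, ne_eq, ENNReal.ofReal_eq_zero, not_le]; positivity
  have hsplit : ∀ x, segmentPotential μ B g (Ioc 0 1) x ≤
      segmentPotential μ B k (Ioc 0 δ) x + μ B * η +
        segmentPotential μ B g (Ioc δ 1) x := by
    intro x
    have h1 : segmentPotential μ B g (Ioc 0 1) x ≤
        segmentPotential μ B g (Ioc 0 δ) x + segmentPotential μ B g (Ioc δ 1) x := by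
      unfold segmentPotential
      rw [← Ioc_union_Ioc_eq_Ioc hδ.le (by linarith : δ ≤ 1)]
      exact lintegral_union_le _ _ _
    refine h1.trans (add_le_add_left ?_ _)
    have hgk : ∀ z, g z ≤ k z + s := by
      intro z
      by_cases hz : z ∈ S
      · simp [k, hz]
      · simpa [k, hz] using not_lt.1 hz
    calc segmentPotential μ B g (Ioc 0 δ) x
        ≤ ∫⁻ t in Ioc 0 δ, ∫⁻ y in B, (k ((1 - t) • x + t • y) + s) ∂μ :=
          lintegral_mono fun t => lintegral_mono fun y => hgk _
      _ = segmentPotential μ B k (Ioc 0 δ) x + μ B * η := by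
          simp_rw [lintegral_add_right _ measurable_const]
          rw [setLIntegral_const, setLIntegral_const, Real.volume_Ioc, sub_zero]
          unfold segmentPotential
          rw [mul_comm s, mul_assoc, hs, hη, ← ENNReal.ofReal_mul (by positivity),
            Real.rpow_sub hδ, Real.rpow_one, Real.rpow_neg hδ.le, div_eq_inv_mul δ]
  have hsub : {x | (μ B ^ (1 - 1 / p) * (∫⁻ y, g y ^ p ∂μ) ^ (1 / p) *
      ENNReal.ofReal ((d / p - 1)⁻¹) + μ B + 1) * η < segmentPotential μ B g (Ioc 0 1) x} ⊆
      {x | η ≤ segmentPotential μ B k (Ioc 0 δ) x} := by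
    intro x hx
    simp only [mem_ofPred_eq] at hx ⊢
    by_contra! hlt
    refine hx.not_ge ((hsplit x).trans ?_)
    have hfar := segmentPotential_far_le μ hg B hp hpd hδ x
    rw [ENNReal.ofReal_mul (inv_nonneg.2 (by linarith))] at hfar
    calc _ ≤ η + μ B * η + μ B ^ (1 - 1 / p) * (∫⁻ y, g y ^ p ∂μ) ^ (1 / p) *
          (ENNReal.ofReal ((d / p - 1)⁻¹) * η) := by gcongr
      _ = _ := by rw [hη]; ring
  refine (measure_mono hsub).trans ?_
  have hmark := mul_meas_ge_le_lintegral (μ := μ) (measurable_segmentPotential μ hk B (Ioc 0 δ)) η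
  have hnear := lintegral_segmentPotential_near_le μ hk B hδ'
  rw [lintegral_indicator hS] at hnear
  have h3 := hmark.trans hnear
  rw [mul_comm, ← ENNReal.le_div_iff_mul_le (Or.inl hη0) (Or.inl ENNReal.ofReal_ne_top)] at h3
  refine h3.trans_eq ?_
  have e : ENNReal.ofReal (δ ^ (d / p)) = ENNReal.ofReal δ / η := by
    rw [hη, ← ENNReal.ofReal_div_of_pos (by positivity), Real.rpow_sub hδ, Real.rpow_one]
    congr 1; field_simp
  rw [e]; simp only [div_eq_mul_inv]; ring

end Potential

lemma enorm_sub_le_lintegral_fderiv {E F : Type*} [NormedAddCommGroup E] [NormedSpace ℝ E]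
    [NormedAddCommGroup F] [NormedSpace ℝ F] [CompleteSpace F] {u : E → F}
    (hu : ContDiff ℝ 1 u) (x y : E) :
    ‖u y - u x‖ₑ ≤
      ‖y - x‖ₑ * ∫⁻ t in Ioc (0 : ℝ) 1, ‖fderiv ℝ u ((1 - t) • x + t • y)‖ₑ := by
  have hcont : Continuous fun t : ℝ => fderiv ℝ u ((1 - t) • x + t • y) :=
    (hu.continuous_fderiv one_ne_zero).comp (by fun_prop)
  have hderiv : ∀ t : ℝ, HasDerivAt (fun t : ℝ => u ((1 - t) • x + t • y))
      (fderiv ℝ u ((1 - t) • x + t • y) (y - x)) t := by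
    intro t
    have h1 : HasDerivAt (fun t : ℝ => (1 - t) • x + t • y) (y - x) t := by
      have := (((hasDerivAt_id t).const_sub 1).smul_const x).add ((hasDerivAt_id t).smul_const y)
      convert! this using 1
      simp [sub_eq_neg_add]
    exact ((hu.differentiable one_ne_zero _).hasFDerivAt).comp_hasDerivAt t h1
  have hftc := intervalIntegral.integral_eq_sub_of_hasDerivAt (a := 0) (b := 1)
    (fun t _ => hderiv t) ((hcont.clm_apply continuous_const).intervalIntegrable 0 1)
  simp only [sub_self, zero_smul, one_smul, zero_add, sub_zero, add_zero] at hftc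
  rw [← hftc, intervalIntegral.integral_of_le zero_le_one]
  refine (enorm_integral_le_lintegral_enorm _).trans ?_
  rw [mul_comm, ← lintegral_mul_const _ hcont.enorm.measurable]
  exact lintegral_mono fun t => ContinuousLinearMap.le_opENorm _ _

section SobolevBall

variable {E : Type*} [NormedAddCommGroup E] [NormedSpace ℝ E] [FiniteDimensional ℝ E]
  [MeasurableSpace E] [BorelSpace E]
  {F : Type*} [NormedAddCommGroup F] [NormedSpace ℝ F] [CompleteSpace F]

variable (μ : Measure E) [μ.IsAddHaarMeasure]

lemma measure_ball_mul_enorm_le {u : E → F} (hu : ContDiff ℝ 1 u) {x₀ x : E} {r : ℝ}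
    (hx : x ∈ ball x₀ r) :
    μ (ball x₀ r) * ‖u x‖ₑ ≤ ∫⁻ y in ball x₀ r, ‖u y‖ₑ ∂μ + ENNReal.ofReal (2 * r) *
      segmentPotential μ (ball x₀ r) ((ball x₀ r).indicator fun z => ‖fderiv ℝ u z‖ₑ)
        (Ioc 0 1) x := by
  set B := ball x₀ r
  set g := B.indicator fun z => ‖fderiv ℝ u z‖ₑ
  have hg : Measurable g :=
    (hu.continuous_fderiv one_ne_zero).enorm.measurable.indicator measurableSet_ball
  have hpt : ∀ y ∈ B, ‖u x‖ₑ ≤ ‖u y‖ₑ + ENNReal.ofReal (2 * r) *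
      ∫⁻ t in Ioc (0 : ℝ) 1, g ((1 - t) • x + t • y) := by
    intro y hy
    have h1 : ‖u x‖ₑ ≤ ‖u y‖ₑ + ‖u y - u x‖ₑ := by
      calc ‖u x‖ₑ = ‖u y - (u y - u x)‖ₑ := by rw [sub_sub_cancel]
        _ ≤ _ := enorm_sub_le
    refine h1.trans ?_
    gcongr
    refine (enorm_sub_le_lintegral_fderiv hu x y).trans ?_
    gcongr ?_ * ?_
    · rw [← ofReal_norm]
      refine ENNReal.ofReal_le_ofReal ?_
      rw [← dist_eq_norm]
      linarith [dist_triangle_right y x x₀, mem_ball.1 hx, mem_ball.1 hy]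
    · refine setLIntegral_mono' measurableSet_Ioc fun t ht => ?_
      have hz : (1 - t) • x + t • y ∈ B :=
        convex_ball x₀ r hx hy (by linarith [ht.2]) ht.1.le (by ring)
      simp [g, hz]
  have hm : Measurable fun z : E × ℝ => g ((1 - z.2) • x + z.2 • z.1) := by fun_prop
  calc μ B * ‖u x‖ₑ = ∫⁻ _ in B, ‖u x‖ₑ ∂μ := by rw [setLIntegral_const, mul_comm]
    _ ≤ ∫⁻ y in B, (‖u y‖ₑ + ENNReal.ofReal (2 * r) *
          ∫⁻ t in Ioc (0 : ℝ) 1, g ((1 - t) • x + t • y)) ∂μ :=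
        setLIntegral_mono' measurableSet_ball hpt
    _ = _ := by
        rw [lintegral_add_left hu.continuous.enorm.measurable, lintegral_const_mul _
          hm.lintegral_prod_right', lintegral_lintegral_swap hm.aemeasurable]
        rfl

/-- **Sobolev inequality on balls**, in normalized form: a `C¹` function on a ball of radius in
`[r₀, r₁]` with `L^p` bounds on itself and its derivative has an `L^{dp/(d-p)}` bound. -/
theorem exists_setLIntegral_ball_rpow_le {p : ℝ} (hp : 1 < p) (hpd : p < finrank ℝ E)
    {r₀ r₁ : ℝ} (hr₀ : 0 < r₀) {D : ℝ≥0∞} (hD : D ≠ ∞) :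
    ∃ C : ℝ≥0∞, C ≠ ∞ ∧ ∀ r ∈ Icc r₀ r₁, ∀ (x₀ : E) (u : E → F), ContDiff ℝ 1 u →
      ∫⁻ x in ball x₀ r, ‖u x‖ₑ ^ p ∂μ ≤ D →
      ∫⁻ x in ball x₀ r, ‖fderiv ℝ u x‖ₑ ^ p ∂μ ≤ D →
      ∫⁻ x in ball x₀ r, ‖u x‖ₑ ^ ((finrank ℝ E : ℝ) * p / (finrank ℝ E - p)) ∂μ ≤ C := by
  set d : ℝ := (finrank ℝ E : ℝ)
  have hp0 : 0 < p := by linarith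
  have hdp0 : 0 < d - p := by linarith
  have hdp : 1 < d / p := by rwa [one_lt_div hp0]
  set a := d / (d - p) with ha_def
  have ha : 1 < a := by rw [ha_def, one_lt_div hdp0]; linarith
  have hq : d * p / (d - p) = a * p := by rw [ha_def]; ring
  have hq0 : 0 < a * p := by positivity
  rw [hq]
  have h1p : 0 < 1 - 1 / p := by
    have : 1 / p < 1 := by rwa [div_lt_one hp0]
    linarith
  set V := μ (ball (0 : E) r₁)
  have hV : V ≠ ∞ := measure_ball_lt_top.ne
  set v := μ (ball (0 : E) r₀)
  have hv : v ≠ 0 := (measure_ball_pos μ 0 hr₀).ne'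
  set A := V ^ (1 - 1 / p) * D ^ (1 / p)
  have hA : A ≠ ∞ := by finiteness
  set H := A * ENNReal.ofReal ((d / p - 1)⁻¹) + V + 1
  have hH : H ≠ ∞ := by finiteness
  set K := (A + ENNReal.ofReal (2 * r₁) * H) / v
  have hK : K ≠ ∞ := by
    refine ENNReal.div_ne_top ?_ hv
    finiteness
  set κ : ℝ := K.toReal + 1
  have hκ : 0 < κ := by positivity
  set m₀ : ℝ := 2 ^ ((d - p) / p)
  have hm₀ : 1 ≤ m₀ := Real.one_le_rpow (by norm_num) (by positivity)
  set W := V * ENNReal.ofReal (2 ^ d)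
  refine ⟨ENNReal.ofReal (κ ^ (a * p)) * (ENNReal.ofReal (a * p) *
    (V * ENNReal.ofReal (m₀ ^ (a * p)) + W * (ENNReal.ofReal (a * p - a))⁻¹ * D)), ?_, ?_⟩
  · have : (ENNReal.ofReal (a * p - a))⁻¹ ≠ ∞ := by
      rw [ENNReal.inv_ne_top]
      simp only [ne_eq, ENNReal.ofReal_eq_zero, not_le]
      nlinarith
    finiteness
  intro r hr x₀ u hu hu1 hu2
  set B := ball x₀ r
  have hBV : μ B ≤ V := by
    rw [Measure.addHaar_ball_center]
    exact measure_mono (ball_subset_ball hr.2)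
  have hvB : v ≤ μ B := by
    rw [Measure.addHaar_ball_center]
    exact measure_mono (ball_subset_ball hr.1)
  set g := B.indicator fun z => ‖fderiv ℝ u z‖ₑ
  have hg : Measurable g :=
    (hu.continuous_fderiv one_ne_zero).enorm.measurable.indicator measurableSet_ball
  have hg' : ∀ x, g x ≠ ∞ := fun x => by
    by_cases hx : x ∈ B <;> simp [g, hx]
  have hgD : ∫⁻ x, g x ^ p ∂μ ≤ D := by
    refine le_trans (le_of_eq ?_) hu2
    rw [← lintegral_indicator measurableSet_ball]
    refine lintegral_congr fun x => ?_
    by_cases hx : x ∈ B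
    · have hx' : x ∈ ball x₀ r := hx
      simp [g, hx, hx']
    · have hx' : x ∉ ball x₀ r := hx
      simp [g, hx, hx', hp0]
  set f : E → ℝ := fun x => ‖u x‖ / κ
  have hf : Measurable f := hu.continuous.norm.measurable.div_const κ
  have hf0 : ∀ x, 0 ≤ f x := fun x => by positivity
  have hlevel : ∀ m, m₀ ≤ m → (μ.restrict B) {x | m < f x} ≤
      W * ENNReal.ofReal (m ^ (-a)) * ∫⁻ x in {x | ENNReal.ofReal (m ^ a) < g x}, g x ∂μ := by
    intro m hm
    have hm0 : 0 < m := by linarith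
    have hm1 : 1 ≤ m := by linarith
    set δ := m ^ (-(p / (d - p)))
    have hδ : 0 < δ := by positivity
    have hδ' : δ ≤ 1 / 2 := by
      calc δ ≤ m₀ ^ (-(p / (d - p))) :=
            Real.rpow_le_rpow_of_nonpos (by linarith) hm (neg_nonpos.2 (by positivity))
        _ = 1 / 2 := by
            rw [← Real.rpow_mul (by norm_num)]
            have : (d - p) / p * -(p / (d - p)) = -1 := by field_simp
            rw [this, Real.rpow_neg_one]; norm_num
    have e1 : δ ^ (1 - d / p) = m := by
      rw [← Real.rpow_mul hm0.le]
      have : -(p / (d - p)) * (1 - d / p) = 1 := by field_simp; ring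
      rw [this, Real.rpow_one]
    have e2 : δ ^ (d / p) = m ^ (-a) := by
      rw [← Real.rpow_mul hm0.le]
      congr 1; rw [ha_def]; field_simp
    have e3 : δ ^ (-(d / p)) = m ^ a := by
      rw [← Real.rpow_mul hm0.le]
      congr 1; rw [ha_def]; field_simp
    have hweak := measure_segmentPotential_gt_le μ hg B hp hpd hδ hδ'
    rw [e1, e2, e3] at hweak
    have hsub : {x | m < f x} ∩ B ⊆ {x | (μ B ^ (1 - 1 / p) * (∫⁻ y, g y ^ p ∂μ) ^ (1 / p) *
        ENNReal.ofReal ((d / p - 1)⁻¹) + μ B + 1) * ENNReal.ofReal m <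
          segmentPotential μ B g (Ioc 0 1) x} := by
      rintro x ⟨hx, hxB⟩
      simp only [mem_ofPred_eq] at hx ⊢
      by_contra! hle
      have hle' : segmentPotential μ B g (Ioc 0 1) x ≤ H * ENNReal.ofReal m := by
        refine hle.trans ?_
        simp only [H, A]
        gcongr
      have hA' : ∫⁻ y in B, ‖u y‖ₑ ∂μ ≤ A := by
        refine (setLIntegral_le_rpow_mul μ hu.continuous.enorm.measurable.aemeasurable hp).trans ?_
        simp only [A]
        gcongr
      have hm1' : 1 ≤ ENNReal.ofReal m := by simpa using hm1
      have h1 : v * ‖u x‖ₑ ≤ (A + ENNReal.ofReal (2 * r₁) * H) * ENNReal.ofReal m := by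
        calc v * ‖u x‖ₑ ≤ μ B * ‖u x‖ₑ := by gcongr
          _ ≤ _ := measure_ball_mul_enorm_le μ hu hxB
          _ ≤ A * ENNReal.ofReal m + ENNReal.ofReal (2 * r₁) * (H * ENNReal.ofReal m) := by
              gcongr
              · exact hA'.trans (le_mul_of_one_le_right' hm1')
              · exact hr.2
          _ = _ := by ring
      have h2 : ‖u x‖ₑ ≤ K * ENNReal.ofReal m := by
        rw [mul_comm v, ← ENNReal.le_div_iff_mul_le (Or.inl hv) (Or.inl measure_ball_lt_top.ne)]
          at h1
        refine h1.trans_eq ?_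
        simp only [K, div_eq_mul_inv]; ring
      have h3 : ‖u x‖ ≤ K.toReal * m := by
        rw [← ENNReal.ofReal_toReal hK, ← ENNReal.ofReal_mul ENNReal.toReal_nonneg,
          ← ofReal_norm, ENNReal.ofReal_le_ofReal_iff (by positivity)] at h2
        exact h2
      rw [lt_div_iff₀ hκ] at hx
      simp only [κ] at hx
      nlinarith
    calc (μ.restrict B) {x | m < f x} = μ ({x | m < f x} ∩ B) :=
          Measure.restrict_apply (measurableSet_lt measurable_const hf)
      _ ≤ _ := (measure_mono hsub).trans hweak
      _ ≤ _ := by simp only [W]; gcongr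
  have hfin := lintegral_rpow_le_of_measure_gt_le μ (μ.restrict B) hf hf0 hg hg' ha hp
    (by linarith) hlevel
  rw [Measure.restrict_apply_univ] at hfin
  calc ∫⁻ x in B, ‖u x‖ₑ ^ (a * p) ∂μ
      = ∫⁻ x in B, ENNReal.ofReal (κ ^ (a * p)) * ENNReal.ofReal (f x ^ (a * p)) ∂μ := by
        refine lintegral_congr fun x => ?_
        rw [← ENNReal.ofReal_mul (by positivity), ← Real.mul_rpow hκ.le (hf0 x)]
        simp only [f]
        rw [mul_div_cancel₀ _ hκ.ne', ← ENNReal.ofReal_rpow_of_nonneg (norm_nonneg _) hq0.le,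
          ofReal_norm]
    _ = ENNReal.ofReal (κ ^ (a * p)) * ∫⁻ x in B, ENNReal.ofReal (f x ^ (a * p)) ∂μ :=
        lintegral_const_mul _ (by fun_prop)
    _ ≤ _ := by gcongr; exact hfin.trans (by gcongr)

end SobolevBall

section Mollification

variable {E : Type*} [NormedAddCommGroup E] [NormedSpace ℝ E]
  [MeasurableSpace E] [BorelSpace E]
  {F : Type*} [NormedAddCommGroup F] [NormedSpace ℝ F]

lemma enorm_integral_smul_rpow_le {α : Type*} [MeasurableSpace α] {μ : Measure α} {φ : α → ℝ}
    (hφ : Measurable φ) (hφ0 : ∀ x, 0 ≤ φ x) (hφ1 : ∫⁻ x, ENNReal.ofReal (φ x) ∂μ = 1)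
    {k : α → F} (hk : StronglyMeasurable k) {p : ℝ} (hp : 1 ≤ p) :
    ‖∫ x, φ x • k x ∂μ‖ₑ ^ p ≤ ∫⁻ x, ENNReal.ofReal (φ x) * ‖k x‖ₑ ^ p ∂μ := by
  have hp0 : 0 < p := by linarith
  have hφm : Measurable fun x => ENNReal.ofReal (φ x) := hφ.ennreal_ofReal
  set ν := μ.withDensity fun x => ENNReal.ofReal (φ x)
  have hν : ∀ g : α → ℝ≥0∞, Measurable g →
      ∫⁻ x, g x ∂ν = ∫⁻ x, ENNReal.ofReal (φ x) * g x ∂μ := fun g hg =>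
    lintegral_withDensity_eq_lintegral_mul _ hφm hg
  have : IsProbabilityMeasure ν := ⟨by
    rw [withDensity_apply _ MeasurableSet.univ, Measure.restrict_univ, hφ1]⟩
  have hkm : Measurable fun x => ‖k x‖ₑ := hk.enorm
  have hjen := eLpNorm'_le_eLpNorm'_of_exponent_le zero_lt_one hp ν hk.aestronglyMeasurable
  rw [eLpNorm'_eq_lintegral_enorm, eLpNorm'_eq_lintegral_enorm] at hjen
  simp only [ENNReal.rpow_one, div_one] at hjen
  rw [← hν _ (hkm.pow_const p)]
  calc ‖∫ x, φ x • k x ∂μ‖ₑ ^ p ≤ (∫⁻ x, ‖k x‖ₑ ∂ν) ^ p := by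
        gcongr
        refine (enorm_integral_le_lintegral_enorm _).trans_eq ?_
        rw [hν _ hkm]
        refine lintegral_congr fun x => ?_
        rw [enorm_smul, Real.enorm_of_nonneg (hφ0 x)]
    _ ≤ ((∫⁻ x, ‖k x‖ₑ ^ p ∂ν) ^ (1 / p)) ^ p := by gcongr
    _ = _ := by rw [← ENNReal.rpow_mul, one_div_mul_cancel hp0.ne', ENNReal.rpow_one]

/-- A `C¹` function whose difference quotients along `e` are bounded by `1` in `L^p(S)` has
derivative along `e` bounded by `1` in `L^p(S)`. -/
lemma lintegral_fderiv_apply_rpow_le {μ : Measure E} {w : E → F} (hw : ContDiff ℝ 1 w) (S : Set E)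
    (e : E) {p h₀ : ℝ} (hp : 0 < p) (hh₀ : 0 < h₀)
    (h : ∀ t : ℝ, 0 < t → t < h₀ →
      ∫⁻ x in S, ‖w (x + t • e) - w x‖ₑ ^ p ∂μ ≤ ENNReal.ofReal (t ^ p)) :
    ∫⁻ x in S, ‖fderiv ℝ w x e‖ₑ ^ p ∂μ ≤ 1 := by
  have hlim : ∀ x, Tendsto (fun t : ℝ => ‖t⁻¹ • (w (x + t • e) - w x)‖ₑ ^ p) (𝓝[>] 0)
      (𝓝 (‖fderiv ℝ w x e‖ₑ ^ p)) := by
    intro x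
    have hline : HasLineDerivAt ℝ w (fderiv ℝ w x e) x e :=
      (hw.differentiable one_ne_zero x).hasFDerivAt.hasLineDerivAt e
    have := hline.tendsto_slope_zero_right
    exact (ENNReal.continuous_rpow_const.tendsto _).comp (this.enorm)
  have hwc := hw.continuous
  calc ∫⁻ x in S, ‖fderiv ℝ w x e‖ₑ ^ p ∂μ
      = ∫⁻ x in S, liminf (fun t : ℝ => ‖t⁻¹ • (w (x + t • e) - w x)‖ₑ ^ p) (𝓝[>] 0) ∂μ :=
        lintegral_congr fun x => (hlim x).liminf_eq.symm
    _ ≤ liminf (fun t : ℝ => ∫⁻ x in S, ‖t⁻¹ • (w (x + t • e) - w x)‖ₑ ^ p ∂μ) (𝓝[>] 0) := by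
        refine lintegral_liminf_le fun t => ?_
        have : Continuous fun x => ‖t⁻¹ • (w (x + t • e) - w x)‖ₑ := by fun_prop
        exact this.measurable.pow_const p
    _ ≤ 1 := by
        refine liminf_le_of_le (by isBoundedDefault) fun b hb => ?_
        have hev : ∀ᶠ t : ℝ in 𝓝[>] 0, 0 < t ∧ t < h₀ := by
          filter_upwards [Ioo_mem_nhdsGT hh₀] with t ht using ht
        obtain ⟨t, hbt, ht0, hth⟩ := (hb.and hev).exists
        refine hbt.trans ?_
        have htp : ENNReal.ofReal (t ^ p) ≠ 0 := by
          simp only [ne_eq, ENNReal.ofReal_eq_zero, not_le]; positivity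
        calc ∫⁻ x in S, ‖t⁻¹ • (w (x + t • e) - w x)‖ₑ ^ p ∂μ
            = ∫⁻ x in S, (ENNReal.ofReal (t ^ p))⁻¹ * ‖w (x + t • e) - w x‖ₑ ^ p ∂μ := by
              refine lintegral_congr fun x => ?_
              rw [enorm_smul, ENNReal.mul_rpow_of_nonneg _ _ hp.le,
                Real.enorm_of_nonneg (by positivity), ENNReal.ofReal_inv_of_pos ht0,
                ENNReal.inv_rpow, ENNReal.ofReal_rpow_of_pos ht0]
          _ = (ENNReal.ofReal (t ^ p))⁻¹ * ∫⁻ x in S, ‖w (x + t • e) - w x‖ₑ ^ p ∂μ := by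
              refine lintegral_const_mul _ ?_
              have : Continuous fun x => ‖w (x + t • e) - w x‖ₑ := by fun_prop
              exact this.measurable.pow_const p
          _ ≤ (ENNReal.ofReal (t ^ p))⁻¹ * ENNReal.ofReal (t ^ p) := by gcongr; exact h t ht0 hth
          _ = 1 := ENNReal.inv_mul_cancel htp ENNReal.ofReal_ne_top

variable [FiniteDimensional ℝ E] {μ : Measure E} [μ.IsAddHaarMeasure]

lemma ContDiffBump.setLIntegral_convolution_rpow_le (φ : ContDiffBump (0 : E)) {f : E → F}
    (hf : StronglyMeasurable f) {p : ℝ} (hp : 1 ≤ p) (S : Set E) {T : ℝ≥0∞}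
    (h : ∀ z ∈ ball (0 : E) φ.rOut, ∫⁻ x in S, ‖f (x - z)‖ₑ ^ p ∂μ ≤ T) :
    ∫⁻ x in S, ‖∫ z, φ.normed μ z • f (x - z) ∂μ‖ₑ ^ p ∂μ ≤ T := by
  have hφc : Continuous (φ.normed μ) := (φ.contDiff_normed (n := 0)).continuous
  have hφ1 : ∫⁻ z, ENNReal.ofReal (φ.normed μ z) ∂μ = 1 := by
    rw [← ofReal_integral_eq_lintegral_ofReal φ.integrable_normed
      (Eventually.of_forall φ.nonneg_normed), φ.integral_normed, ENNReal.ofReal_one]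
  have hm : Measurable fun z : E × E =>
      ENNReal.ofReal (φ.normed μ z.2) * ‖f (z.1 - z.2)‖ₑ ^ p := by
    have : StronglyMeasurable fun z : E × E => f (z.1 - z.2) :=
      hf.comp_measurable (measurable_fst.sub measurable_snd)
    exact (hφc.measurable.comp measurable_snd).ennreal_ofReal.mul (this.enorm.pow_const p)
  calc ∫⁻ x in S, ‖∫ z, φ.normed μ z • f (x - z) ∂μ‖ₑ ^ p ∂μ
      ≤ ∫⁻ x in S, ∫⁻ z, ENNReal.ofReal (φ.normed μ z) * ‖f (x - z)‖ₑ ^ p ∂μ ∂μ :=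
        lintegral_mono fun x => enorm_integral_smul_rpow_le hφc.measurable φ.nonneg_normed hφ1
          (hf.comp_measurable (measurable_const.sub measurable_id)) hp
    _ = ∫⁻ z, ENNReal.ofReal (φ.normed μ z) * ∫⁻ x in S, ‖f (x - z)‖ₑ ^ p ∂μ ∂μ := by
        rw [lintegral_lintegral_swap hm.aemeasurable]
        refine lintegral_congr fun z => lintegral_const_mul _ ?_
        exact (hf.comp_measurable (measurable_id.sub measurable_const)).enorm.pow_const p
    _ ≤ ∫⁻ z, ENNReal.ofReal (φ.normed μ z) * T ∂μ := by
        refine lintegral_mono fun z => ?_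
        by_cases hz : z ∈ ball (0 : E) φ.rOut
        · dsimp only; gcongr; exact h z hz
        · rw [← φ.support_normed_eq (μ := μ), Function.mem_support, not_not] at hz
          simp [hz]
    _ = T := by rw [lintegral_mul_const _ hφc.measurable.ennreal_ofReal, hφ1, one_mul]

end Mollification

lemma EuclideanSpace.enorm_rpow_le_sum {n : ℕ} {F : Type*} [NormedAddCommGroup F]
    [NormedSpace ℝ F] (L : EuclideanSpace ℝ (Fin n) →L[ℝ] F) {p : ℝ} (hp : 1 ≤ p) :
    ‖L‖ₑ ^ p ≤ (n : ℝ≥0∞) ^ (p - 1) * ∑ s, ‖L (EuclideanSpace.single s 1)‖ₑ ^ p := by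
  have h1 : ‖L‖ ≤ ∑ s, ‖L (EuclideanSpace.single s 1)‖ := by
    refine L.opNorm_le_bound (by positivity) fun x => ?_
    have hx : x = ∑ s, x s • EuclideanSpace.single s (1 : ℝ) := by
      have := (EuclideanSpace.basisFun (Fin n) ℝ).sum_repr x
      simpa using this.symm
    calc ‖L x‖ = ‖∑ s, x s • L (EuclideanSpace.single s 1)‖ := by
          conv_lhs => rw [hx, map_sum]
          simp only [map_smul]
      _ ≤ ∑ s, ‖x s • L (EuclideanSpace.single s 1)‖ := norm_sum_le _ _
      _ ≤ ∑ s, ‖L (EuclideanSpace.single s 1)‖ * ‖x‖ := by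
          refine Finset.sum_le_sum fun s _ => ?_
          rw [norm_smul, mul_comm]
          gcongr
          exact PiLp.norm_apply_le x s
      _ = _ := by rw [Finset.sum_mul]
  have h2 : ‖L‖ₑ ≤ ∑ s, ‖L (EuclideanSpace.single s 1)‖ₑ := by
    simp only [← ofReal_norm]
    rw [← ENNReal.ofReal_sum_of_nonneg fun _ _ => norm_nonneg _]
    exact ENNReal.ofReal_le_ofReal h1
  calc ‖L‖ₑ ^ p ≤ (∑ s, ‖L (EuclideanSpace.single s 1)‖ₑ) ^ p := by gcongr
    _ ≤ _ := by
      simpa using ENNReal.rpow_sum_le_const_mul_sum_rpow (s := Finset.univ)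
        (f := fun s => ‖L (EuclideanSpace.single s 1)‖ₑ) hp

section DifferenceQuotient

open scoped Convolution

/-- Normalized form of the embedding: `L^p` bounds by `1` on `f` and by `t` on its coordinate
differences over a ball imply an `L^{np/(n-p)}` bound on that ball. -/
theorem exists_setLIntegral_ball_rpow_le_of_difference {n : ℕ} {F : Type*} [NormedAddCommGroup F]
    [NormedSpace ℝ F] [CompleteSpace F] {p : ℝ} (hp : 1 < p) (hpn : p < n) {ρ h₀ : ℝ}
    (hρ : 0 < ρ) (hh₀ : 0 < h₀) :
    ∃ C : ℝ≥0∞, C ≠ ∞ ∧ ∀ (x₀ : EuclideanSpace ℝ (Fin n)) (f : EuclideanSpace ℝ (Fin n) → F),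
      StronglyMeasurable f → ∫⁻ x, ‖f x‖ₑ ^ p ≤ 1 →
      (∀ s : Fin n, ∀ t : ℝ, 0 < t → t < h₀ →
        ∫⁻ x in ball x₀ ρ, ‖f (x + t • EuclideanSpace.single s 1) - f x‖ₑ ^ p ≤
          ENNReal.ofReal (t ^ p)) →
      ∫⁻ x in ball x₀ ρ, ‖f x‖ₑ ^ ((n : ℝ) * p / ((n : ℝ) - p)) ≤ C := by
  have hp0 : 0 < p := by linarith
  set D : ℝ≥0∞ := (n : ℝ≥0∞) ^ (p - 1) * n + 1
  have hD : D ≠ ∞ := by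
    have : (n : ℝ≥0∞) ^ (p - 1) ≠ ∞ :=
      ENNReal.rpow_ne_top_of_nonneg (by linarith) (ENNReal.natCast_ne_top n)
    finiteness
  have hpd : p < finrank ℝ (EuclideanSpace ℝ (Fin n)) := by simpa using hpn
  obtain ⟨C, hC, hsob⟩ := exists_setLIntegral_ball_rpow_le (F := F)
    (volume : Measure (EuclideanSpace ℝ (Fin n))) hp hpd (r₁ := ρ) (half_pos hρ) hD
  rw [finrank_euclideanSpace_fin] at hsob
  refine ⟨C, hC, fun x₀ f hf hf1 hdiff => ?_⟩
  set q := (n : ℝ) * p / ((n : ℝ) - p)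
  have hmem : MemLp f (ENNReal.ofReal p) := by
    refine ⟨hf.aestronglyMeasurable, ?_⟩
    rw [eLpNorm_lt_top_iff_lintegral_rpow_enorm_lt_top (by simpa using hp0) ENNReal.ofReal_ne_top,
      ENNReal.toReal_ofReal hp0.le]
    exact hf1.trans_lt ENNReal.one_lt_top
  have hloc : LocallyIntegrable f := hmem.locallyIntegrable (by simpa using hp.le)
  set ε : ℕ → ℝ := fun k => ρ / (k + 2)
  have hε : ∀ k, 0 < ε k := fun k => by positivity
  have hερ : ∀ k, ε k ≤ ρ / 2 := fun k => by
    simp only [ε]; gcongr; simp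
  have hε_lim : Tendsto ε atTop (𝓝 0) :=
    tendsto_const_nhds.div_atTop (tendsto_atTop_add_const_right _ _ tendsto_natCast_atTop_atTop)
  let φ : ℕ → ContDiffBump (0 : EuclideanSpace ℝ (Fin n)) := fun k =>
    ⟨ε k / 2, ε k, half_pos (hε k), half_lt_self (hε k)⟩
  set w : ℕ → EuclideanSpace ℝ (Fin n) → F := fun k =>
    (φ k).normed volume ⋆[ContinuousLinearMap.lsmul ℝ ℝ, volume] f
  have hw_apply : ∀ k x, w k x = ∫ z, (φ k).normed volume z • f (x - z) := fun k x => rfl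
  have hw_exists : ∀ k x, Integrable fun z => (φ k).normed volume z • f (x - z) := fun k x =>
    (φ k).hasCompactSupport_normed.convolutionExists_left (ContinuousLinearMap.lsmul ℝ ℝ)
      ((φ k).contDiff_normed (n := 0)).continuous hloc x
  have hw : ∀ k, ContDiff ℝ 1 (w k) := fun k =>
    (φ k).hasCompactSupport_normed.contDiff_convolution_left _ (φ k).contDiff_normed hloc
  have hbound : ∀ k, ∫⁻ x in ball x₀ (ρ - ε k), ‖w k x‖ₑ ^ q ≤ C := by
    intro k
    refine hsob (ρ - ε k) ⟨by linarith [hερ k], by linarith [hε k]⟩ x₀ (w k) (hw k) ?_ ?_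
    · refine le_trans ?_ (le_add_self : (1 : ℝ≥0∞) ≤ D)
      simp only [hw_apply]
      refine (φ k).setLIntegral_convolution_rpow_le hf hp.le _ fun z _ => ?_
      refine (setLIntegral_le_lintegral _ _).trans ?_
      rwa [lintegral_sub_right_eq_self (fun x => ‖f x‖ₑ ^ p) z]
    · have hdir : ∀ s : Fin n, ∫⁻ x in ball x₀ (ρ - ε k),
          ‖fderiv ℝ (w k) x (EuclideanSpace.single s 1)‖ₑ ^ p ≤ 1 := by
        intro s
        refine lintegral_fderiv_apply_rpow_le (hw k) _ _ hp0 hh₀ fun t ht0 hth => ?_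
        set g := fun x => f (x + t • EuclideanSpace.single s 1) - f x
        have hg : StronglyMeasurable g :=
          (hf.comp_measurable (measurable_id.add_const _)).sub hf
        have hwg : ∀ x, w k (x + t • EuclideanSpace.single s 1) - w k x =
            ∫ z, (φ k).normed volume z • g (x - z) := by
          intro x
          rw [hw_apply, hw_apply, ← integral_sub (hw_exists k _) (hw_exists k _)]
          refine integral_congr_ae (Eventually.of_forall fun z => ?_)
          simp only [g]
          rw [← smul_sub, sub_add_eq_add_sub]
        simp only [hwg]
        refine (φ k).setLIntegral_convolution_rpow_le hg hp.le _ fun z hz => ?_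
        refine le_trans ?_ (hdiff s t ht0 hth)
        rw [← lintegral_indicator measurableSet_ball, ← lintegral_indicator measurableSet_ball,
          ← lintegral_sub_right_eq_self ((ball x₀ ρ).indicator fun x => ‖g x‖ₑ ^ p) z]
        refine lintegral_mono fun x => ?_
        by_cases hx : x ∈ ball x₀ (ρ - ε k)
        · have hxz : x - z ∈ ball x₀ ρ := by
            rw [mem_ball, dist_eq_norm] at hx ⊢
            have hz' : ‖z‖ < ε k := by simpa using hz
            calc ‖x - z - x₀‖ = ‖(x - x₀) - z‖ := by congr 1; abel
              _ ≤ ‖x - x₀‖ + ‖z‖ := norm_sub_le _ _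
              _ < ρ := by linarith
          rw [indicator_of_mem hx, indicator_of_mem hxz]
        · simp [indicator_of_notMem hx]
      have hmeas : ∀ s : Fin n, Measurable fun x =>
          ‖fderiv ℝ (w k) x (EuclideanSpace.single s 1)‖ₑ ^ p := fun s =>
        (((hw k).continuous_fderiv one_ne_zero).clm_apply
          continuous_const).enorm.measurable.pow_const p
      calc ∫⁻ x in ball x₀ (ρ - ε k), ‖fderiv ℝ (w k) x‖ₑ ^ p
          ≤ ∫⁻ x in ball x₀ (ρ - ε k), (n : ℝ≥0∞) ^ (p - 1) *
              ∑ s, ‖fderiv ℝ (w k) x (EuclideanSpace.single s 1)‖ₑ ^ p :=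
            lintegral_mono fun x => EuclideanSpace.enorm_rpow_le_sum _ hp.le
        _ = (n : ℝ≥0∞) ^ (p - 1) * ∑ s, ∫⁻ x in ball x₀ (ρ - ε k),
              ‖fderiv ℝ (w k) x (EuclideanSpace.single s 1)‖ₑ ^ p := by
            rw [lintegral_const_mul _ (Finset.measurable_fun_sum _ fun s _ => hmeas s),
              lintegral_finsetSum _ fun s _ => hmeas s]
        _ ≤ (n : ℝ≥0∞) ^ (p - 1) * ∑ _s : Fin n, 1 := by
            gcongr with s; exact hdir s
        _ ≤ D := by simp [D]
  have hae : ∀ᵐ x, Tendsto (fun k => w k x) atTop (𝓝 (f x)) :=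
    ContDiffBump.ae_convolution_tendsto_right_of_locallyIntegrable (K := 2) hε_lim
      (Eventually.of_forall fun k => by simp only [φ]; linarith) hloc
  have hlim : ∀ᵐ x ∂volume.restrict (ball x₀ ρ), ‖f x‖ₑ ^ q = liminf (fun k =>
      (ball x₀ (ρ - ε k)).indicator (fun x => ‖w k x‖ₑ ^ q) x) atTop := by
    filter_upwards [ae_restrict_of_ae hae, ae_restrict_mem measurableSet_ball] with x hx hxB
    refine (Tendsto.liminf_eq ?_).symm
    have h1 : Tendsto (fun k => ‖w k x‖ₑ ^ q) atTop (𝓝 (‖f x‖ₑ ^ q)) :=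
      (ENNReal.continuous_rpow_const.tendsto _).comp hx.enorm
    refine h1.congr' ?_
    have hlt : ∀ᶠ k in atTop, ε k < ρ - dist x x₀ :=
      hε_lim.eventually_lt_const (by linarith [mem_ball.1 hxB])
    filter_upwards [hlt] with k hk
    rw [indicator_of_mem]
    rw [mem_ball]; linarith
  have hwm : ∀ k, Measurable fun x => ‖w k x‖ₑ ^ q := fun k =>
    (hw k).continuous.enorm.measurable.pow_const q
  calc ∫⁻ x in ball x₀ ρ, ‖f x‖ₑ ^ q
      = ∫⁻ x in ball x₀ ρ, liminf (fun k =>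
          (ball x₀ (ρ - ε k)).indicator (fun x => ‖w k x‖ₑ ^ q) x) atTop :=
        lintegral_congr_ae hlim
    _ ≤ liminf (fun k => ∫⁻ x in ball x₀ ρ,
          (ball x₀ (ρ - ε k)).indicator (fun x => ‖w k x‖ₑ ^ q) x) atTop :=
        lintegral_liminf_le fun k => (hwm k).indicator measurableSet_ball
    _ ≤ C := by
        refine liminf_le_of_le (by isBoundedDefault) fun b hb => ?_
        obtain ⟨k, hk⟩ := hb.exists
        refine (hk.trans (setLIntegral_le_lintegral _ _)).trans ?_
        rw [lintegral_indicator measurableSet_ball]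
        exact hbound k

end DifferenceQuotient

lemma lintegral_enorm_rpow_eq_ofReal_integral {α F : Type*} [MeasurableSpace α]
    [NormedAddCommGroup F] {μ : Measure α} {f : α → F} {p : ℝ} (hp : 0 ≤ p)
    (hf : Integrable (fun x => ‖f x‖ ^ p) μ) :
    ∫⁻ x, ‖f x‖ₑ ^ p ∂μ = ENNReal.ofReal (∫ x, ‖f x‖ ^ p ∂μ) := by
  rw [ofReal_integral_eq_lintegral_ofReal hf (Eventually.of_forall fun x => by positivity)]
  refine lintegral_congr fun x => ?_
  rw [← ENNReal.ofReal_rpow_of_nonneg (norm_nonneg _) hp, ofReal_norm]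

/-- Let `n ≥ 2`, `1 < p < n`, `0 < ρ < R`, `F ∈ L^p(B_R(x₀), ℝᴺ)`, and
suppose there is `M > 0` with
`∑_{s=1}^n ∫_{B_ρ(x₀)} |F(x + h eₛ) − F(x)|^p dx ≤ M^p |h|^p` for all `0 < |h| < (R−ρ)/2`.
Then `F ∈ L^{np/(n−p)}(B_ρ(x₀), ℝᴺ)` and
`‖F‖_{L^{np/(n−p)}(B_ρ)} ≤ c (M + ‖F‖_{L^p(B_R)})`, with `c = c(n, N, p, ρ, R)`. -/
theorem stmt_12 (n N : ℕ) (hn : 2 ≤ n) (p : ℝ) (hp₁ : 1 < p) (hpn : p < n)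
    (ρ R : ℝ) (hρ : 0 < ρ) (hρR : ρ < R) :
    ∃ c : ℝ, 0 < c ∧
      ∀ (x₀ : EuclideanSpace ℝ (Fin n))
        (F : EuclideanSpace ℝ (Fin n) → EuclideanSpace ℝ (Fin N)),
        AEStronglyMeasurable F (volume.restrict (ball x₀ R)) →
        IntegrableOn (fun x => ‖F x‖ ^ p) (ball x₀ R) →
        ∀ M : ℝ, 0 < M →
        (∀ h : ℝ, 0 < |h| → |h| < (R - ρ) / 2 →
          ∑ s : Fin n,
            ∫ x in ball x₀ ρ, ‖F (x + h • EuclideanSpace.single s 1) - F x‖ ^ p ≤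
              M ^ p * |h| ^ p) →
        IntegrableOn (fun x => ‖F x‖ ^ ((n : ℝ) * p / ((n : ℝ) - p))) (ball x₀ ρ) ∧
        (∫ x in ball x₀ ρ, ‖F x‖ ^ ((n : ℝ) * p / ((n : ℝ) - p))) ^ (((n : ℝ) - p) / ((n : ℝ) * p)) ≤
          c * (M + (∫ x in ball x₀ R, ‖F x‖ ^ p) ^ (1 / p)) := by
  have hp0 : 0 < p := by linarith
  have hnp : 0 < (n : ℝ) - p := by linarith
  set q := (n : ℝ) * p / ((n : ℝ) - p) with hq_def
  have hq0 : 0 < q := by positivity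
  have hqinv : ((n : ℝ) - p) / ((n : ℝ) * p) = 1 / q := by rw [hq_def, one_div_div]
  obtain ⟨C, hC, hmain⟩ := exists_setLIntegral_ball_rpow_le_of_difference
    (F := EuclideanSpace ℝ (Fin N)) hp₁ hpn hρ (half_pos (sub_pos.2 hρR))
  refine ⟨C.toReal ^ (1 / q) + 1, by positivity, fun x₀ F hF hFp M hM hdiff => ?_⟩
  set I := ∫ x in ball x₀ R, ‖F x‖ ^ p
  have hI : 0 ≤ I := integral_nonneg fun x => by positivity
  set K := M + I ^ (1 / p)
  have hK : 0 < K := by positivity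
  have hIK : I ≤ K ^ p := by
    rw [← Real.rpow_inv_le_iff_of_pos hI hK.le hp0, ← one_div]
    linarith
  have hMK : M ^ p ≤ K ^ p := by
    gcongr
    exact le_add_of_nonneg_right (by positivity)
  set G := (ball x₀ R).indicator (hF.mk F)
  have hG : StronglyMeasurable G := hF.stronglyMeasurable_mk.indicator measurableSet_ball
  have hFG : ∀ᵐ x, x ∈ ball x₀ R → G x = F x := by
    filter_upwards [(ae_restrict_iff' measurableSet_ball).1 hF.ae_eq_mk] with x hx hxB
    rw [hx hxB]
    exact indicator_of_mem hxB _
  have hscale : ∀ (r : ℝ), 0 ≤ r → ∀ y : EuclideanSpace ℝ (Fin N),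
      ‖K⁻¹ • y‖ₑ ^ r = ENNReal.ofReal (K ^ (-r)) * ‖y‖ₑ ^ r := by
    intro r hr y
    rw [enorm_smul, ENNReal.mul_rpow_of_nonneg _ _ hr, Real.enorm_of_nonneg (by positivity),
      ENNReal.ofReal_rpow_of_pos (by positivity), Real.inv_rpow hK.le, Real.rpow_neg hK.le]
  have hGp : ∫⁻ x, ‖G x‖ₑ ^ p = ENNReal.ofReal I := by
    rw [← lintegral_enorm_rpow_eq_ofReal_integral hp0.le hFp,
      ← lintegral_indicator measurableSet_ball]
    refine lintegral_congr_ae ?_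
    filter_upwards [hFG] with x hx
    by_cases hxB : x ∈ ball x₀ R
    · rw [indicator_of_mem hxB, hx hxB]
    · simp [G, indicator_of_notMem hxB, hp0]
  have hGmem : MemLp G (ENNReal.ofReal p) := by
    refine ⟨hG.aestronglyMeasurable, ?_⟩
    rw [eLpNorm_lt_top_iff_lintegral_rpow_enorm_lt_top (by simpa using hp0) ENNReal.ofReal_ne_top,
      ENNReal.toReal_ofReal hp0.le, hGp]
    exact ENNReal.ofReal_lt_top
  have hGK : ∫⁻ x in ball x₀ ρ, ‖K⁻¹ • G x‖ₑ ^ q ≤ C := by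
    refine hmain x₀ (fun x => K⁻¹ • G x) 
      ((continuous_const_smul K⁻¹).comp_stronglyMeasurable hG) ?_ fun s t ht0 hth => ?_
    · simp only [hscale p hp0.le]
      rw [lintegral_const_mul _ (hG.enorm.pow_const p), hGp, ← ENNReal.ofReal_mul (by positivity),
        ENNReal.ofReal_le_one, Real.rpow_neg hK.le, inv_mul_le_iff₀ (by positivity), mul_one]
      exact hIK
    · set e := t • (EuclideanSpace.single s 1 : EuclideanSpace ℝ (Fin n))
      have hnorm : ‖e‖ = t := by simp [e, norm_smul, abs_of_pos ht0]
      have htrans : MemLp (fun x => G (x + e)) (ENNReal.ofReal p) :=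
        hGmem.comp_measurePreserving (measurePreserving_add_right volume e)
      have hint : Integrable fun x => ‖G (x + e) - G x‖ ^ p := by
        have := (htrans.sub hGmem).integrable_norm_rpow (by simpa using hp0) ENNReal.ofReal_ne_top
        simpa only [ENNReal.toReal_ofReal hp0.le, Pi.sub_apply] using this
      have hFe : ∀ᵐ x, x + e ∈ ball x₀ R → G (x + e) = F (x + e) :=
        (measurePreserving_add_right volume e).quasiMeasurePreserving.ae hFG
      have hGd : StronglyMeasurable fun x => G (x + e) - G x :=
        (hG.comp_measurable (measurable_id.add_const e)).sub hG
      have hcongr : ∫ x in ball x₀ ρ, ‖G (x + e) - G x‖ ^ p =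
          ∫ x in ball x₀ ρ, ‖F (x + e) - F x‖ ^ p := by
        refine setIntegral_congr_ae measurableSet_ball ?_
        filter_upwards [hFG, hFe] with x hx hxe hxB
        have hxe' : x + e ∈ ball x₀ R := by
          rw [mem_ball, dist_eq_norm] at hxB ⊢
          calc ‖x + e - x₀‖ = ‖(x - x₀) + e‖ := by congr 1; abel
            _ ≤ ‖x - x₀‖ + ‖e‖ := norm_add_le _ _
            _ < R := by linarith
        rw [hx (ball_subset_ball hρR.le hxB), hxe hxe']
      have hle : ∫ x in ball x₀ ρ, ‖F (x + e) - F x‖ ^ p ≤ M ^ p * t ^ p := by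
        have h1 := hdiff t (abs_pos.2 ht0.ne') (by rwa [abs_of_pos ht0])
        rw [abs_of_pos ht0] at h1
        exact (Finset.single_le_sum
          (f := fun s : Fin n => ∫ x in ball x₀ ρ,
            ‖F (x + t • EuclideanSpace.single s 1) - F x‖ ^ p)
          (fun s _ => integral_nonneg fun x => by positivity) (Finset.mem_univ s)).trans h1
      simp only [← smul_sub, hscale p hp0.le]
      rw [lintegral_const_mul _ (hGd.enorm.pow_const p),
        lintegral_enorm_rpow_eq_ofReal_integral hp0.le hint.integrableOn, hcongr,
        ← ENNReal.ofReal_mul (by positivity)]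
      refine ENNReal.ofReal_le_ofReal ?_
      rw [Real.rpow_neg hK.le, inv_mul_le_iff₀ (by positivity)]
      exact hle.trans (by gcongr)
  have hFq : ∫⁻ x in ball x₀ ρ, ‖F x‖ₑ ^ q ≤ ENNReal.ofReal (K ^ q) * C := by
    have hcongr : ∫⁻ x in ball x₀ ρ, ‖F x‖ₑ ^ q = ∫⁻ x in ball x₀ ρ, ‖G x‖ₑ ^ q := by
      refine setLIntegral_congr_fun_ae measurableSet_ball ?_
      filter_upwards [hFG] with x hx hxB
      rw [hx (ball_subset_ball hρR.le hxB)]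
    simp only [hscale q hq0.le] at hGK
    rw [lintegral_const_mul _ (hG.enorm.pow_const q)] at hGK
    calc ∫⁻ x in ball x₀ ρ, ‖F x‖ₑ ^ q
        = ENNReal.ofReal (K ^ q) *
            (ENNReal.ofReal (K ^ (-q)) * ∫⁻ x in ball x₀ ρ, ‖G x‖ₑ ^ q) := by
          rw [hcongr, ← mul_assoc, ← ENNReal.ofReal_mul (by positivity), ← Real.rpow_add hK,
            add_neg_cancel, Real.rpow_zero, ENNReal.ofReal_one, one_mul]
      _ ≤ _ := by gcongr
  have hFqm : AEStronglyMeasurable (fun x => ‖F x‖ ^ q) (volume.restrict (ball x₀ ρ)) :=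
    ((hF.mono_set (ball_subset_ball hρR.le)).norm.aemeasurable.pow_const q).aestronglyMeasurable
  have hFqi : IntegrableOn (fun x => ‖F x‖ ^ q) (ball x₀ ρ) := by
    refine ⟨hFqm, ?_⟩
    rw [hasFiniteIntegral_iff_enorm]
    refine lt_of_le_of_lt (lintegral_mono fun x => ?_) (hFq.trans_lt (by finiteness))
    rw [Real.enorm_of_nonneg (by positivity), ← ENNReal.ofReal_rpow_of_nonneg (norm_nonneg _)
      hq0.le, ofReal_norm]
  refine ⟨hFqi, ?_⟩
  rw [lintegral_enorm_rpow_eq_ofReal_integral hq0.le hFqi, ← ENNReal.ofReal_toReal hC,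
    ← ENNReal.ofReal_mul (by positivity), ENNReal.ofReal_le_ofReal_iff (by positivity)] at hFq
  rw [hqinv]
  calc (∫ x in ball x₀ ρ, ‖F x‖ ^ q) ^ (1 / q) ≤ (K ^ q * C.toReal) ^ (1 / q) := by
        gcongr
    _ = K * C.toReal ^ (1 / q) := by
        rw [Real.mul_rpow (by positivity) (by positivity), ← Real.rpow_mul hK.le,
          mul_one_div_cancel hq0.ne', Real.rpow_one]
    _ ≤ _ := by rw [mul_comm]; gcongr; linarith
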